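/- Fix an integer n ≥ 2, a real B > 0, set A = −((n−2)/2)·√(B/(n−1)), f(r) = 1 − 2A/r² − B/r⁴ and r₀ = (B/(n−1))^{1/4}. Let ε ∈ {−1, 1}, t₁, θ₁ ∈ ℝ, and let θ₀, r₁ be real constants with r₁ > r₀·|θ₀|/2 and r₁ > 0. For r > r₀ define α(r) = arcsin √((4r₁²r² − 4r₀²r₁²)/(4r₁²r² − r₀⁴θ₀²)), k² = 1 − 1/n + r₀²θ₀²/(4n·r₁²), t(r) = t₁ + (ε/r₁)·[ 2r₁·√(r⁴ + (n−2)·r₀²·r² − B)/√(4r₁²r² − r₀⁴θ₀²) − √n·r₀·E(α(r), k²) + (r₀/√n)·F(α(r), k²) ], and θ(r) = θ₁ + (ε·r₀·θ₀/(√n·r₁))·F(α(r), k²). Then t and θ are differentiable on (r₀, ∞) with t'(r) = ε/(r₁·√((1 − r₀⁴θ₀²/(4r₁²r²))·f(r))) and θ'(r) = ε·r₀²·θ₀/(r₁·r²·√((1 − r₀⁴θ₀²/(4r₁²r²))·f(r))), and t(r) → t₁, θ(r) → θ₁ as r → r₀⁺. (This is the geodesic of the scalar-flat metric of Eguchi–Hanson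 type with φ, ψ constant, passing through the removable singularity r₀.) -/

import Mathlib

/-- Incomplete elliptic integral of the first kind. -/
noncomputable def ellF (a k2 : ℝ) : ℝ :=
  ∫ ρ in (0:ℝ)..a, 1 / Real.sqrt (1 - k2 * Real.sin ρ ^ 2)

/-- Incomplete elliptic integral of the second kind. -/
noncomputable def ellE (a k2 : ℝ) : ℝ :=
  ∫ ρ in (0:ℝ)..a, Real.sqrt (1 - k2 * Real.sin ρ ^ 2)

lemma aux_pos {k2 : ℝ} (hk : k2 < 1) (ρ : ℝ) : 0 < 1 - k2 * Real.sin ρ ^ 2 := by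
  have h1 := Real.sin_sq_add_cos_sq ρ
  have h2 := sq_nonneg (Real.sin ρ)
  have h3 := sq_nonneg (Real.cos ρ)
  by_cases h : k2 ≤ 0
  · nlinarith
  · nlinarith

lemma ellF_deriv {k2 : ℝ} (hk : k2 < 1) (a : ℝ) :
    HasDerivAt (fun a => ellF a k2) (1 / Real.sqrt (1 - k2 * Real.sin a ^ 2)) a := by
  have hc : Continuous (fun ρ : ℝ => 1 / Real.sqrt (1 - k2 * Real.sin ρ ^ 2)) := by
    refine Continuous.div (by fun_prop) (by fun_prop) ?_
    intro x
    exact (Real.sqrt_pos.2 (aux_pos hk x)).ne'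
  exact intervalIntegral.integral_hasDerivAt_right (hc.intervalIntegrable _ _)
    (hc.stronglyMeasurableAtFilter _ _) hc.continuousAt

lemma ellE_deriv (k2 : ℝ) (a : ℝ) :
    HasDerivAt (fun a => ellE a k2) (Real.sqrt (1 - k2 * Real.sin a ^ 2)) a := by
  have hc : Continuous (fun ρ : ℝ => Real.sqrt (1 - k2 * Real.sin ρ ^ 2)) := by fun_prop
  exact intervalIntegral.integral_hasDerivAt_right (hc.intervalIntegrable _ _)
    (hc.stronglyMeasurableAtFilter _ _) hc.continuousAt

lemma alpha_deriv {a c r : ℝ} (hca : c < a) (hr : a < r ^ 2) :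
    HasDerivAt (fun r : ℝ => Real.arcsin (Real.sqrt ((r ^ 2 - a) / (r ^ 2 - c))))
      (r * Real.sqrt (a - c) / ((r ^ 2 - c) * Real.sqrt (r ^ 2 - a))) r := by
  have hd : 0 < r ^ 2 - c := by linarith
  have hp : 0 < r ^ 2 - a := by linarith
  have he : 0 < a - c := by linarith
  have hq : 0 < (r ^ 2 - a) / (r ^ 2 - c) := div_pos hp hd
  have h1 : HasDerivAt (fun r : ℝ => (r ^ 2 - a) / (r ^ 2 - c))
      ((2 * r * (r ^ 2 - c) - (r ^ 2 - a) * (2 * r)) / (r ^ 2 - c) ^ 2) r := by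
    have hh : HasDerivAt (fun r : ℝ => r ^ 2) (2 * r) r := by simpa using hasDerivAt_pow 2 r
    exact (hh.sub_const a).div (hh.sub_const c) hd.ne'
  have h2 := h1.sqrt hq.ne'
  have hlt : Real.sqrt ((r ^ 2 - a) / (r ^ 2 - c)) < 1 := by
    rw [Real.sqrt_lt' one_pos, div_lt_iff₀ hd]; linarith
  have hpos := Real.sqrt_pos.2 hq
  have h3 := (Real.hasDerivAt_arcsin (by linarith) hlt.ne).comp r h2
  refine h3.congr_deriv ?_
  rw [Real.sq_sqrt hq.le]
  have e1 : 1 - (r ^ 2 - a) / (r ^ 2 - c) = (a - c) / (r ^ 2 - c) := by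
    field_simp; ring
  rw [e1, Real.sqrt_div he.le, Real.sqrt_div hp.le]
  have hP := Real.sqrt_pos.2 hp
  have hE := Real.sqrt_pos.2 he
  have hD := Real.sqrt_pos.2 hd
  have sE := Real.sq_sqrt he.le
  have sD := Real.sq_sqrt hd.le
  set P := Real.sqrt (r ^ 2 - a)
  set E := Real.sqrt (a - c)
  set D := Real.sqrt (r ^ 2 - c)
  have e2 : 2 * r * (r ^ 2 - c) - (r ^ 2 - a) * (2 * r) = 2 * r * E ^ 2 := by rw [sE]; ring
  rw [e2, ← sD]
  field_simp

/-- geodesics of the scalar-flat metrics of Eguchi–Hanson type with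
constant `φ, ψ`, passing through the removable singularity `r₀`. -/
theorem stmt_4 (n : ℕ) (hn : 2 ≤ n) (B : ℝ) (hB : 0 < B)
    (A r₀ : ℝ)
    (hA : A = -(((n : ℝ) - 2) / 2) * Real.sqrt (B / ((n : ℝ) - 1)))
    (hr₀ : r₀ = (B / ((n : ℝ) - 1)) ^ ((1 : ℝ) / 4))
    (f : ℝ → ℝ) (hf : ∀ r, f r = 1 - 2 * A / r ^ 2 - B / r ^ 4)
    (ε : ℝ) (hε : ε = 1 ∨ ε = -1) (t₁ θ₁ θ₀ r₁ : ℝ)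
    (hr₁pos : 0 < r₁) (hr₁ : r₁ > r₀ * |θ₀| / 2)
    (α : ℝ → ℝ) (hα : ∀ r, α r = Real.arcsin (Real.sqrt
      ((4 * r₁ ^ 2 * r ^ 2 - 4 * r₀ ^ 2 * r₁ ^ 2) / (4 * r₁ ^ 2 * r ^ 2 - r₀ ^ 4 * θ₀ ^ 2))))
    (k2 : ℝ) (hk2 : k2 = 1 - 1 / (n : ℝ) + r₀ ^ 2 * θ₀ ^ 2 / (4 * (n : ℝ) * r₁ ^ 2))
    (t θ : ℝ → ℝ)
    (ht : ∀ r, t r = t₁ + (ε / r₁) *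
      (2 * r₁ * Real.sqrt (r ^ 4 + ((n : ℝ) - 2) * r₀ ^ 2 * r ^ 2 - B)
          / Real.sqrt (4 * r₁ ^ 2 * r ^ 2 - r₀ ^ 4 * θ₀ ^ 2)
        - Real.sqrt (n : ℝ) * r₀ * ellE (α r) k2
        + (r₀ / Real.sqrt (n : ℝ)) * ellF (α r) k2))
    (hθ : ∀ r, θ r = θ₁ + (ε * r₀ * θ₀ / (Real.sqrt (n : ℝ) * r₁)) * ellF (α r) k2) :
    (∀ r, r₀ < r → HasDerivAt t
      (ε / (r₁ * Real.sqrt ((1 - r₀ ^ 4 * θ₀ ^ 2 / (4 * r₁ ^ 2 * r ^ 2)) * f r))) r)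
    ∧ (∀ r, r₀ < r → HasDerivAt θ
      (ε * r₀ ^ 2 * θ₀ /
        (r₁ * r ^ 2 * Real.sqrt ((1 - r₀ ^ 4 * θ₀ ^ 2 / (4 * r₁ ^ 2 * r ^ 2)) * f r))) r)
    ∧ Filter.Tendsto t (nhdsWithin r₀ (Set.Ioi r₀)) (nhds t₁)
    ∧ Filter.Tendsto θ (nhdsWithin r₀ (Set.Ioi r₀)) (nhds θ₁) := by
  have hnR : (2 : ℝ) ≤ n := by exact_mod_cast hn
  obtain ⟨N, hN⟩ : ∃ N : ℝ, N = n := ⟨_, rfl⟩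
  simp only [← hN] at *
  have hb : 0 < B / (N - 1) := div_pos hB (by linarith)
  have hr0 : 0 < r₀ := by rw [hr₀]; positivity
  have hr4 : r₀ ^ 4 = B / (N - 1) := by
    rw [hr₀, ← Real.rpow_natCast, ← Real.rpow_mul hb.le]; norm_num
  have hsq : Real.sqrt (B / (N - 1)) = r₀ ^ 2 := by
    rw [← hr4, show r₀ ^ 4 = (r₀ ^ 2) ^ 2 by ring, Real.sqrt_sq (by positivity)]
  have hBv : B = (N - 1) * r₀ ^ 4 := by
    rw [hr4]; field_simp [show N - 1 ≠ 0 by linarith]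
  obtain ⟨c, hc⟩ : ∃ c : ℝ, c = r₀ ^ 4 * θ₀ ^ 2 / (4 * r₁ ^ 2) := ⟨_, rfl⟩
  obtain ⟨a, ha⟩ : ∃ a : ℝ, a = r₀ ^ 2 := ⟨_, rfl⟩
  have hapos : 0 < a := by rw [ha]; positivity
  have hcm : r₀ ^ 4 * θ₀ ^ 2 = 4 * r₁ ^ 2 * c := by rw [hc]; field_simp
  have hca : c < a := by
    have h1 : (r₀ * |θ₀| / 2) ^ 2 < r₁ ^ 2 := by
      apply pow_lt_pow_left₀ hr₁ (by positivity) (by norm_num)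
    have h2 : r₀ ^ 2 * θ₀ ^ 2 < 4 * r₁ ^ 2 := by
      have : (r₀ * |θ₀| / 2) ^ 2 = r₀ ^ 2 * θ₀ ^ 2 / 4 := by
        rw [div_pow, mul_pow, sq_abs]; norm_num
      linarith
    rw [hc, ha, div_lt_iff₀ (by positivity)]
    nlinarith [mul_lt_mul_of_pos_left h2 (show 0 < r₀ ^ 2 by positivity)]
  have hk2' : k2 = 1 - (a - c) / (N * a) := by
    rw [hk2, hc, ha]; field_simp; ring
  have hk : k2 < 1 := by
    have : 0 < (a - c) / (N * a) := div_pos (by linarith) (by positivity)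
    linarith
  have hα' : α = fun r : ℝ => Real.arcsin (Real.sqrt ((r ^ 2 - a) / (r ^ 2 - c))) := by
    funext r
    rw [hα, hcm, ← ha, show 4 * r₁ ^ 2 * r ^ 2 - 4 * a * r₁ ^ 2 = (4 * r₁ ^ 2) * (r ^ 2 - a) by ring,
      show 4 * r₁ ^ 2 * r ^ 2 - 4 * r₁ ^ 2 * c = (4 * r₁ ^ 2) * (r ^ 2 - c) by ring,
      mul_div_mul_left _ _ (by positivity)]
  have hfr : ∀ r, f r = 1 + (N - 2) * a / r ^ 2 - (N - 1) * a ^ 2 / r ^ 4 := by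
    intro r
    rw [hf, hA, hsq, hBv, ha]; ring
  have ht' : t = fun r => t₁ + (ε / r₁) *
      (Real.sqrt ((r ^ 2 - a) * (r ^ 2 + (N - 1) * a)) / Real.sqrt (r ^ 2 - c)
        - Real.sqrt N * r₀ * ellE (α r) k2
        + (r₀ / Real.sqrt N) * ellF (α r) k2) := by
    funext r
    rw [ht, hcm, show 4 * r₁ ^ 2 * r ^ 2 - 4 * r₁ ^ 2 * c = (2 * r₁) ^ 2 * (r ^ 2 - c) by ring,
      Real.sqrt_mul (by positivity), Real.sqrt_sq (by positivity),
      mul_div_mul_left _ _ (by positivity),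
      show r ^ 4 + (N - 2) * r₀ ^ 2 * r ^ 2 - B = (r ^ 2 - a) * (r ^ 2 + (N - 1) * a) by
        rw [hBv, ha]; ring]
  have hθ' : θ = fun r => θ₁ + (ε * r₀ * θ₀ / (Real.sqrt N * r₁)) * ellF (α r) k2 := funext hθ
  have hNs : 0 < Real.sqrt N := Real.sqrt_pos.2 (by linarith)
  have sN := Real.sq_sqrt (show (0:ℝ) ≤ N by linarith)
  have main : ∀ r, r₀ < r → ∃ P W D : ℝ, 0 < P ∧ 0 < W ∧ 0 < D ∧ P ^ 2 = r ^ 2 - a ∧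
      W ^ 2 = r ^ 2 + (N - 1) * a ∧ D ^ 2 = r ^ 2 - c ∧
      Real.sqrt ((1 - r₀ ^ 4 * θ₀ ^ 2 / (4 * r₁ ^ 2 * r ^ 2)) * f r) = P * W * D / r ^ 3 ∧
      Real.sqrt ((r ^ 2 - a) * (r ^ 2 + (N - 1) * a)) = P * W ∧ Real.sqrt (r ^ 2 - c) = D ∧
      HasDerivAt (fun r => ellF (α r) k2) (r * (Real.sqrt N * r₀) / (P * W * D)) r ∧
      HasDerivAt (fun r => ellE (α r) k2)
        (r * (a - c) * W / (Real.sqrt N * r₀ * D ^ 3 * P)) r := by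
    intro r hr
    have hrpos : 0 < r := hr0.trans hr
    have har : a < r ^ 2 := by rw [ha]; exact pow_lt_pow_left₀ hr hr0.le (by norm_num)
    have hp : 0 < r ^ 2 - a := by linarith
    have hd : 0 < r ^ 2 - c := by linarith
    have he : 0 < a - c := by linarith
    have hw : 0 < r ^ 2 + (N - 1) * a := by
      have : 0 < (N - 1) * a := mul_pos (by linarith) hapos
      positivity
    have hP := Real.sqrt_pos.2 hp
    have hE := Real.sqrt_pos.2 he
    have hD := Real.sqrt_pos.2 hd
    have hW := Real.sqrt_pos.2 hw
    have sP := Real.sq_sqrt hp.le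
    have sE := Real.sq_sqrt he.le
    have sD := Real.sq_sqrt hd.le
    have sW := Real.sq_sqrt hw.le
    have hda := alpha_deriv hca har
    rw [← hα'] at hda
    have hsin : Real.sin (α r) ^ 2 = (r ^ 2 - a) / (r ^ 2 - c) := by
      have hq : 0 < (r ^ 2 - a) / (r ^ 2 - c) := div_pos hp hd
      have hle : Real.sqrt ((r ^ 2 - a) / (r ^ 2 - c)) ≤ 1 := by
        rw [Real.sqrt_le_iff, one_pow, div_le_one hd]; exact ⟨zero_le_one, by linarith⟩
      rw [hα']
      simp only
      rw [Real.sin_arcsin (by linarith [Real.sqrt_nonneg ((r ^ 2 - a) / (r ^ 2 - c))]) hle,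
        Real.sq_sqrt hq.le]
    have hΔ : Real.sqrt (1 - k2 * Real.sin (α r) ^ 2) =
        Real.sqrt (a - c) * Real.sqrt (r ^ 2 + (N - 1) * a) /
          (Real.sqrt N * r₀ * Real.sqrt (r ^ 2 - c)) := by
      rw [Real.sqrt_eq_iff_mul_self_eq_of_pos (by positivity)]
      rw [← sq, div_pow, mul_pow, mul_pow, mul_pow, sE, sW, sN, sD, ← ha, hsin, hk2']
      field_simp
      ring
    refine ⟨_, _, _, hP, hW, hD, sP, sW, sD, ?_, Real.sqrt_mul hp.le _, rfl, ?_, ?_⟩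
    · rw [Real.sqrt_eq_iff_mul_self_eq_of_pos (by positivity)]
      rw [← sq, div_pow, mul_pow, mul_pow, sP, sW, sD, hfr, hcm]
      field_simp
      ring
    · refine ((ellF_deriv hk (α r)).comp r hda).congr_deriv ?_
      rw [hΔ, ← sD]
      rw [Real.sqrt_sq hD.le]
      field_simp
    · refine ((ellE_deriv k2 (α r)).comp r hda).congr_deriv ?_
      rw [hΔ, ← sE, ← sD]
      rw [Real.sqrt_sq hD.le, Real.sqrt_sq hE.le]
      field_simp
  refine ⟨?_, ?_, ?_, ?_⟩
  · intro r hr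
    have hrpos : 0 < r := hr0.trans hr
    obtain ⟨P, W, D, hP, hW, hD, sP, sW, sD, h1, h2, h3, hF, hE⟩ := main r hr
    have hh : HasDerivAt (fun r : ℝ => r ^ 2) (2 * r) r := by simpa using hasDerivAt_pow 2 r
    have hpw : HasDerivAt (fun r : ℝ => (r ^ 2 - a) * (r ^ 2 + (N - 1) * a))
        (2 * r * (r ^ 2 + (N - 1) * a) + (r ^ 2 - a) * (2 * r)) r :=
      (hh.sub_const a).mul (hh.add_const _)
    have hg1 := hpw.sqrt (by rw [← sP, ← sW]; positivity)
    have hg2 := (hh.sub_const c).sqrt (by rw [← sD]; positivity)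
    have hg := hg1.div hg2 (by rw [h3]; positivity)
    rw [ht', h1]
    refine ((((hg.sub (hE.const_mul (Real.sqrt N * r₀))).add
      (hF.const_mul (r₀ / Real.sqrt N))).const_mul (ε / r₁)).const_add t₁).congr_deriv ?_
    rw [h2, h3, ← sP, ← sW]
    have ea : r₀ ^ 2 = r ^ 2 - P ^ 2 := by rw [← ha, sP]; ring
    have eac : a - c = D ^ 2 - P ^ 2 := by rw [sD, sP]; ring
    rw [eac]
    field_simp
    rw [ea]
    ring
  · intro r hr
    have hrpos : 0 < r := hr0.trans hr
    obtain ⟨P, W, D, hP, hW, hD, sP, sW, sD, h1, h2, h3, hF, hE⟩ := main r hr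
    rw [hθ', h1]
    refine ((hF.const_mul _).const_add θ₁).congr_deriv ?_
    field_simp
  all_goals
    have hd0 : r₀ ^ 2 - c ≠ 0 := by rw [← ha]; linarith
    have hac : ContinuousAt α r₀ := by
      rw [hα']
      refine Real.continuous_arcsin.continuousAt.comp (Real.continuous_sqrt.continuousAt.comp ?_)
      exact ContinuousAt.div (by fun_prop) (by fun_prop) hd0
    have ha0 : α r₀ = 0 := by rw [hα']; simp [ha]
    have hFc : ContinuousAt (fun r => ellF (α r) k2) r₀ :=
      (ellF_deriv hk (α r₀)).continuousAt.comp hac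
    have hEc : ContinuousAt (fun r => ellE (α r) k2) r₀ :=
      (ellE_deriv k2 (α r₀)).continuousAt.comp hac
    have hF0 : ellF (α r₀) k2 = 0 := by rw [ha0]; simp [ellF]
    have hE0 : ellE (α r₀) k2 = 0 := by rw [ha0]; simp [ellE]
  · have hv : t r₀ = t₁ := by
      rw [ht']; simp only; rw [hF0, hE0, ha]; simp
    have hct : ContinuousAt t r₀ := by
      rw [ht']
      have hq : ContinuousAt (fun r : ℝ => Real.sqrt ((r ^ 2 - a) * (r ^ 2 + (N - 1) * a)) /
          Real.sqrt (r ^ 2 - c)) r₀ := by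
        refine ContinuousAt.div (by fun_prop) (by fun_prop) ?_
        exact (Real.sqrt_pos.2 (by rw [← ha]; linarith)).ne'
      exact continuousAt_const.add (continuousAt_const.mul
        ((hq.sub (continuousAt_const.mul hEc)).add (continuousAt_const.mul hFc)))
    have := hct.tendsto
    rw [hv] at this
    exact this.mono_left nhdsWithin_le_nhds
  · have hv : θ r₀ = θ₁ := by
      rw [hθ']; simp only; rw [hF0]; simp
    have hct : ContinuousAt θ r₀ := by
      rw [hθ']
      exact continuousAt_const.add (continuousAt_const.mul hFc)
    have := hct.tendsto
    rw [hv] at this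
    exact this.mono_left nhdsWithin_le_nhds
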